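/- arXiv:2211.12439 — 5 statements merged into one kernel-verified Lean document; each statement's English description precedes it below -/
import Mathlib

section
/- Let H and K be complex Hilbert spaces and V : H → K a bounded linear operator with δ := ‖V†V − 1‖ < 1. Then the positive operator V†V is invertible, and there exists a linear isometry W : H → K (namely W = V (V†V)^{-1/2}) such that ‖W − V‖ ≤ δ. -/
open Filter Topology

namespace ContinuousLinearMap

variable {H K : Type*} [NormedAddCommGroup H] [InnerProductSpace ℂ H]
  [NormedAddCommGroup K] [InnerProductSpace ℂ K]

/-- If `S` is a positive operator, then `1 + S` is bounded below by `1`. -/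
theorem norm_le_norm_add_apply_of_nonneg {S : H →L[ℂ] H} (hS : 0 ≤ S) (y : H) :
    ‖y‖ ≤ ‖y + S y‖ := by
  have hpos : 0 ≤ RCLike.re (inner ℂ y (S y)) :=
    ((nonneg_iff_isPositive S).mp hS).re_inner_nonneg_right y
  have hsq := norm_add_sq (𝕜 := ℂ) y (S y)
  refine (sq_le_sq₀ (norm_nonneg _) (norm_nonneg _)).mp ?_
  nlinarith [sq_nonneg ‖S y‖]

/-- A positive operator `S` is at least as close to `1` as its square is. -/
theorem norm_sub_apply_le_of_nonneg {S : H →L[ℂ] H} (hS : 0 ≤ S) (x : H) :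
    ‖x - S x‖ ≤ ‖S * S - 1‖ * ‖x‖ :=
  calc ‖x - S x‖ ≤ ‖(x - S x) + S (x - S x)‖ := norm_le_norm_add_apply_of_nonneg hS _
    _ = ‖(S * S - 1) x‖ := by
      rw [← norm_neg]
      congr 1
      simp
    _ ≤ ‖S * S - 1‖ * ‖x‖ := le_opNorm _ _

/-- `V` and the positive square root of `V†V` have the same pointwise norms. -/
theorem norm_sqrt_adjoint_comp_self_apply [CompleteSpace H] [CompleteSpace K]
    (V : H →L[ℂ] K) (y : H) : ‖CFC.sqrt ((adjoint V).comp V) y‖ = ‖V y‖ := by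
  set A := (adjoint V).comp V with hA
  have hA0 : 0 ≤ A := (nonneg_iff_isPositive A).mpr (isPositive_adjoint_comp_self V)
  have hsa : adjoint (CFC.sqrt A) = CFC.sqrt A :=
    (IsSelfAdjoint.of_nonneg (CFC.sqrt_nonneg A)).star_eq
  have hmul : (adjoint (CFC.sqrt A)).comp (CFC.sqrt A) = (adjoint V).comp V := by
    rw [hsa]
    exact CFC.sqrt_mul_sqrt_self A hA0
  rw [apply_norm_eq_sqrt_inner_adjoint_left, apply_norm_eq_sqrt_inner_adjoint_left, hmul]

end ContinuousLinearMap

/-- Lemma 8.2 (norm estimate): a near-isometry `V` with `‖V†V − 1‖ < 1` has invertible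
`V†V` and is within `‖V†V − 1‖` in operator norm of a genuine isometry `W`. -/
theorem near_isometry_close_to_isometry
    {H K : Type*} [NormedAddCommGroup H] [InnerProductSpace ℂ H] [CompleteSpace H]
    [NormedAddCommGroup K] [InnerProductSpace ℂ K] [CompleteSpace K]
    (V : H →L[ℂ] K)
    (hδ : ‖(ContinuousLinearMap.adjoint V).comp V - 1‖ < 1) :
    IsUnit ((ContinuousLinearMap.adjoint V).comp V) ∧
      ∃ W : H →L[ℂ] K, Isometry W ∧
        ‖W - V‖ ≤ ‖(ContinuousLinearMap.adjoint V).comp V - 1‖ := by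
  set A := (ContinuousLinearMap.adjoint V).comp V with hA
  have hA0 : 0 ≤ A := (ContinuousLinearMap.nonneg_iff_isPositive A).mpr
    (ContinuousLinearMap.isPositive_adjoint_comp_self V)
  have hunit : IsUnit A := by
    rw [norm_sub_rev] at hδ
    simpa using isUnit_one_sub_of_norm_lt_one hδ
  refine ⟨hunit, ?_⟩
  obtain ⟨u, hu⟩ := (CFC.isUnit_sqrt_iff A hA0).mpr hunit
  have hnorm (x : H) : ‖V.comp (↑u⁻¹ : H →L[ℂ] H) x‖ = ‖x‖ := by
    rw [ContinuousLinearMap.comp_apply, ← V.norm_sqrt_adjoint_comp_self_apply, ← hA, ← hu,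
      ← mul_apply_eq_comp, u.mul_inv, one_apply_eq_self]
  refine ⟨V.comp (↑u⁻¹ : H →L[ℂ] H), AddMonoidHomClass.isometry_of_norm _ hnorm,
    ContinuousLinearMap.opNorm_le_bound _ (norm_nonneg _) fun x ↦ ?_⟩
  have hux : (↑u⁻¹ : H →L[ℂ] H) (CFC.sqrt A x) = x := by
    rw [← hu, ← mul_apply_eq_comp, u.inv_mul, one_apply_eq_self]
  calc ‖(V.comp (↑u⁻¹ : H →L[ℂ] H) - V) x‖
      = ‖V.comp (↑u⁻¹ : H →L[ℂ] H) (x - CFC.sqrt A x)‖ := by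
        simp [map_sub, hux]
    _ = ‖x - CFC.sqrt A x‖ := hnorm _
    _ ≤ ‖A - 1‖ * ‖x‖ := by
        simpa only [CFC.sqrt_mul_sqrt_self A hA0] using
          ContinuousLinearMap.norm_sub_apply_le_of_nonneg (CFC.sqrt_nonneg A) x
end

section
/- Let A and B be unital C*-algebras and let β : A → B and α : B → A be linear, unital, star-preserving, contractive maps satisfying the operator Schwarz inequality (β(x)*β(x) ≤ β(x*x) for all x ∈ A, and α(y)*α(y) ≤ α(y*y) for all y ∈ B). Suppose ‖α(β(x)) − x‖ ≤ ε‖x‖ for all x ∈ A. Then for every n ∈ A: ‖α(β(n)*β(n)) − α(β(n))*α(β(n))‖ ≤ 3ε‖n‖². -/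
open UniformSpace

/-- In a complex star-ordered C⋆-ring, `star` is automatically conjugate-linear. -/
theorem CStarRing.starModule_complex (A : Type*) [NormedRing A] [StarRing A] [CStarRing A]
    [PartialOrder A] [StarOrderedRing A] [NormedAlgebra ℂ A] : StarModule ℂ A := by
  have hreal (r : ℝ) (x : A) : star ((r : ℂ) • x) = (r : ℂ) • star x := by
    simpa using map_real_smul (starAddEquiv : A ≃+ A) continuous_star r x
  set i : A := algebraMap ℂ A Complex.I with hi
  have hii : i * i = -1 := by rw [hi, ← map_mul, Complex.I_mul_I, map_neg, map_one]
  have hcomm (x : A) : i * x = x * i := Algebra.commutes Complex.I x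
  have hcomm' (x : A) : star i * x = x * star i := by
    simpa using congrArg star (hcomm (star x)).symm
  have hss : star i * star i = -1 := by simpa using congrArg star hii
  set e : A := i * star i with he
  have hes : star e = e := by simp [he]
  have hee : e * e = 1 := by
    calc e * e = (i * i) * (star i * star i) := by
          rw [he, mul_assoc, ← mul_assoc (star i) i, hcomm' i]; simp only [mul_assoc]
      _ = 1 := by rw [hii, hss]; simp
  have hq : (1 - e) * (1 - e) = (2 : ℂ) • (1 - e) := by
    rw [two_smul, sub_mul, one_mul, mul_sub, hee, mul_one]; abel
  have heq : e * (1 - e) = -(1 - e) := by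
    rw [mul_sub, hee]; simp
  have hpos : 0 ≤ (2 : ℂ) • (1 - e) := by
    have := star_mul_self_nonneg (1 - e)
    rwa [star_sub, star_one, hes, hq] at this
  have hneg : 0 ≤ -((2 : ℂ) • (1 - e)) := by
    have := star_mul_self_nonneg (i * (1 - e))
    rwa [star_mul, star_sub, star_one, hes, mul_assoc, ← mul_assoc (star i), hcomm' i, ← he,
      heq, mul_neg, hq] at this
  have hone : e = 1 := by
    have h0 := le_antisymm (neg_nonneg.mp hneg) hpos
    exact (sub_eq_zero.mp ((smul_eq_zero_iff_right two_ne_zero).mp h0)).symm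
  have hstar : star i = -i := by
    have h := congrArg (i * ·) hone
    simp only [he, ← mul_assoc, hii, mul_one, neg_mul, one_mul] at h
    exact neg_eq_iff_eq_neg.mp h
  have hI (x : A) : star (Complex.I • x) = -(Complex.I • star x) := by
    rw [Algebra.smul_def, ← hi, star_mul, hstar, mul_neg, ← hcomm, hi, ← Algebra.smul_def]
  refine ⟨fun c x => ?_⟩
  rw [← Complex.re_add_im c, add_smul, mul_smul, star_add, hreal, hreal, hI]
  simp only [star_add, star_mul', add_smul, Complex.star_def, Complex.conj_ofReal,
    Complex.conj_I, mul_smul, neg_smul, smul_neg]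

namespace UniformSpace.Completion

variable {A : Type*} [NormedRing A] [StarRing A] [CStarRing A]

noncomputable instance instStarOfCStarRing : Star (Completion A) := ⟨Completion.map star⟩

theorem coe_star (a : A) : ((star a : A) : Completion A) = star (a : Completion A) :=
  (Completion.map_coe star_isometry.uniformContinuous a).symm

instance instContinuousStarOfCStarRing : ContinuousStar (Completion A) :=
  ⟨Completion.continuous_map⟩

noncomputable instance instStarRingOfCStarRing : StarRing (Completion A) where
  star_involutive x := by
    induction x using Completion.induction_on with
    | hp => exact isClosed_eq (by fun_prop) (by fun_prop)
    | ih a => rw [← coe_star, ← coe_star, star_star]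
  star_mul x y := by
    induction x, y using Completion.induction_on₂ with
    | hp => exact isClosed_eq (by fun_prop) (by fun_prop)
    | ih a b => simp only [← coe_star, ← coe_mul, star_mul]
  star_add x y := by
    induction x, y using Completion.induction_on₂ with
    | hp => exact isClosed_eq (by fun_prop) (by fun_prop)
    | ih a b => simp only [← coe_star, ← coe_add, star_add]

instance instCStarRing : CStarRing (Completion A) where
  norm_mul_self_le x := by
    induction x using Completion.induction_on with
    | hp => exact isClosed_le (by fun_prop) (by fun_prop)
    | ih a => simp only [← coe_star, ← coe_mul, norm_coe, CStarRing.norm_star_mul_self, le_refl]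

variable [NormedAlgebra ℂ A]

instance instIsScalarTowerComplex : IsScalarTower ℂ (Completion A) (Completion A) where
  smul_assoc c x y := by
    change c • x * y = c • (x * y)
    induction x, y using Completion.induction_on₂ with
    | hp =>
      exact isClosed_eq ((continuous_fst.const_smul c).mul continuous_snd)
        ((continuous_fst.mul continuous_snd).const_smul c)
    | ih a b => simp only [← coe_smul, ← coe_mul, smul_mul_assoc]

instance instSMulCommClassComplex : SMulCommClass ℂ (Completion A) (Completion A) where
  smul_comm c x y := by
    change c • (x * y) = x * c • y
    induction x, y using Completion.induction_on₂ with
    | hp =>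
      exact isClosed_eq ((continuous_fst.mul continuous_snd).const_smul c)
        (continuous_fst.mul (continuous_snd.const_smul c))
    | ih a b => simp only [← coe_smul, ← coe_mul, mul_smul_comm]

noncomputable instance instNormedAlgebraComplex : NormedAlgebra ℂ (Completion A) where
  toAlgebra := Algebra.ofModule smul_mul_assoc fun c x y => mul_smul_comm c x y
  norm_smul_le c x := norm_smul_le c x

variable [StarModule ℂ A]

instance instStarModuleComplex : StarModule ℂ (Completion A) where
  star_smul c x := by
    induction x using Completion.induction_on with
    | hp =>
      exact isClosed_eq (continuous_star.comp (continuous_id.const_smul c))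
        (continuous_star.const_smul (star c))
    | ih a => rw [← coe_smul, ← coe_star, ← coe_star, star_smul, coe_smul]

/-- The completion of a complex pre-C⋆-algebra is a C⋆-algebra. -/
noncomputable instance instCStarAlgebra : CStarAlgebra (Completion A) where
  toCompleteSpace := inferInstance

end UniformSpace.Completion

/-- The norm is monotone on the positive cone, without assuming completeness. -/
theorem CStarRing.norm_le_norm_of_nonneg_of_le {A : Type*} [NormedRing A] [StarRing A]
    [CStarRing A] [PartialOrder A] [StarOrderedRing A] [NormedAlgebra ℂ A]
    {a b : A} (ha : 0 ≤ a) (hab : a ≤ b) : ‖a‖ ≤ ‖b‖ := by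
  have := CStarRing.starModule_complex A
  let _ := CStarAlgebra.spectralOrder (Completion A)
  have := CStarAlgebra.spectralOrderedRing (Completion A)
  have hcoe {x : A} (hx : 0 ≤ x) : 0 ≤ (x : Completion A) := by
    rw [StarOrderedRing.nonneg_iff] at hx
    induction hx using AddSubmonoid.closure_induction with
    | mem x hx =>
      obtain ⟨s, rfl⟩ := hx
      simpa only [Completion.coe_mul, Completion.coe_star] using
        star_mul_self_nonneg (s : Completion A)
    | zero => exact le_rfl
    | add x y _ _ hx hy => simpa only [Completion.coe_add] using add_nonneg hx hy
  have hle : (a : Completion A) ≤ b := by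
    simpa only [Completion.coe_sub, sub_nonneg] using hcoe (sub_nonneg.mpr hab)
  simpa only [Completion.norm_coe] using
    CStarAlgebra.norm_le_norm_of_nonneg_of_le (hcoe ha) hle

/-- An additive map satisfying the Schwarz inequality is monotone. -/
theorem monotone_of_schwarz {A B F : Type*} [NonUnitalRing A] [StarRing A] [PartialOrder A]
    [StarOrderedRing A] [NonUnitalRing B] [StarRing B] [PartialOrder B] [StarOrderedRing B]
    [FunLike F B A] [AddMonoidHomClass F B A] (f : F)
    (hf : ∀ y, star (f y) * f y ≤ f (star y * y)) : Monotone f := by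
  intro x y hxy
  suffices ∀ z, 0 ≤ z → 0 ≤ f z by simpa using this (y - x) (sub_nonneg.mpr hxy)
  intro z hz
  rw [StarOrderedRing.nonneg_iff] at hz
  induction hz using AddSubmonoid.closure_induction with
  | mem z hz =>
    obtain ⟨s, rfl⟩ := hz
    exact (star_mul_self_nonneg _).trans (hf s)
  | zero => simp
  | add x y _ _ hx hy => simpa only [map_add] using add_nonneg hx hy

/-- Intermediate estimate in Lemma 8.7: for unital star-preserving contractive maps
`β : A → B`, `α : B → A` satisfying the operator Schwarz inequality with
`‖α(β(x)) − x‖ ≤ ε‖x‖`, one has `‖α(β(n)*β(n)) − α(β(n))*α(β(n))‖ ≤ 3ε‖n‖²`. -/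
theorem approx_recovery_schwarz_gap_estimate
    {A B : Type*}
    [NormedRing A] [StarRing A] [CStarRing A] [PartialOrder A] [StarOrderedRing A]
    [NormedAlgebra ℂ A]
    [NormedRing B] [StarRing B] [CStarRing B] [PartialOrder B] [StarOrderedRing B]
    [NormedAlgebra ℂ B]
    (β : A →ₗ[ℂ] B) (α : B →ₗ[ℂ] A)
    (hβ1 : β 1 = 1) (hα1 : α 1 = 1)
    (hβstar : ∀ x, β (star x) = star (β x)) (hαstar : ∀ y, α (star y) = star (α y))
    (hβcon : ∀ x, ‖β x‖ ≤ ‖x‖) (hαcon : ∀ y, ‖α y‖ ≤ ‖y‖)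
    (hβsch : ∀ x, star (β x) * β x ≤ β (star x * x))
    (hαsch : ∀ y, star (α y) * α y ≤ α (star y * y))
    (ε : ℝ)
    (hrec : ∀ x, ‖α (β x) - x‖ ≤ ε * ‖x‖) :
    ∀ n : A, ‖α (star (β n) * β n) - star (α (β n)) * α (β n)‖ ≤ 3 * ε * ‖n‖ ^ 2 := by
  intro n
  have hlow : 0 ≤ α (star (β n) * β n) - star (α (β n)) * α (β n) := sub_nonneg.mpr (hαsch _)
  have hupp := sub_le_sub_right (monotone_of_schwarz α hαsch (hβsch n))
    (star (α (β n)) * α (β n))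
  refine (CStarRing.norm_le_norm_of_nonneg_of_le hlow hupp).trans ?_
  set m := α (β n)
  have hm : ‖m‖ ≤ ‖n‖ := (hαcon _).trans (hβcon n)
  have hmn : ‖m - n‖ ≤ ε * ‖n‖ := hrec n
  have hnn : ‖α (β (star n * n)) - star n * n‖ ≤ ε * (‖n‖ * ‖n‖) := by
    simpa only [CStarRing.norm_star_mul_self] using hrec (star n * n)
  have h1 : ‖star (m - n) * m‖ ≤ ε * ‖n‖ * ‖n‖ := by
    refine (norm_mul_le _ _).trans ?_
    rw [norm_star]
    exact mul_le_mul hmn hm (norm_nonneg _) ((norm_nonneg _).trans hmn)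
  have h2 : ‖star n * (m - n)‖ ≤ ‖n‖ * (ε * ‖n‖) := by
    refine (norm_mul_le _ _).trans ?_
    rw [norm_star]
    exact mul_le_mul_of_nonneg_left hmn (norm_nonneg _)
  have hdecomp : α (β (star n * n)) - star m * m =
      (α (β (star n * n)) - star n * n) - star (m - n) * m - star n * (m - n) := by
    rw [star_sub]; noncomm_ring
  rw [hdecomp]
  refine (norm_sub_le _ _).trans ?_
  have := norm_sub_le (α (β (star n * n)) - star n * n) (star (m - n) * m)
  nlinarith
end

section
/- Let H be a complex Hilbert space, (K_N) a sequence of complex Hilbert spaces, and V_N : H → K_N bounded linear operators. Let (π_k)_{k∈ℕ} be a nondecreasing sequence of orthogonal projections on H (π_k π_{k+1} = π_k) whose ranges have dense union. Assume that for every ε > 0 and every k there exists N₀ such that ‖π_k (V_N†V_N − 1) π_k‖ ≤ ε for all N ≥ N₀. Then there exists a monotone function k : ℕ → ℕ with k(N) → ∞ such that, setting Ṽ_N := V_N π_{k(N)}: (i) ‖Ṽ_N†Ṽ_N − π_{k(N)}‖ → 0; (ii) sup_N ‖Ṽ_N‖ < ∞; (iii) ‖(Ṽ_N†Ṽ_N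 − 1)ψ‖ → 0 for every ψ ∈ H; (iv) ‖(V_N − Ṽ_N)ψ‖ → 0 for every ψ in the union of the ranges of the π_k. -/
open Filter Topology ContinuousLinearMap

/-- If each `p k` holds eventually, then `p (k N) N` holds eventually along some monotone
`k` tending to infinity. -/
theorem exists_monotone_tendsto_eventually_diagonal {p : ℕ → ℕ → Prop}
    (h : ∀ k, ∀ᶠ N in atTop, p k N) :
    ∃ k : ℕ → ℕ, Monotone k ∧ Tendsto k atTop atTop ∧ ∀ᶠ N in atTop, p (k N) N := by
  classical
  choose N₀ hN₀ using fun k => eventually_atTop.1 (h k)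
  let k : ℕ → ℕ := fun N => Nat.findGreatest (fun k => ∀ j ≤ k, N₀ j ≤ N) N
  refine ⟨k, fun M N hMN => ?_, tendsto_atTop.2 fun b => ?_, ?_⟩
  · exact Nat.findGreatest_mono (fun _ hn j hj => (hn j hj).trans hMN) hMN
  · have hb : ∀ᶠ N in atTop, ∀ j ∈ Set.Iic b, N₀ j ≤ N :=
      (eventually_all_finite (Set.finite_Iic b)).2 fun j _ => eventually_ge_atTop (N₀ j)
    filter_upwards [hb, eventually_ge_atTop b] with N hN hbN
    exact Nat.le_findGreatest hbN hN
  · filter_upwards [eventually_ge_atTop (N₀ 0)] with N hN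
    have hspec : ∀ j ≤ k N, N₀ j ≤ N :=
      Nat.findGreatest_spec (P := fun k => ∀ j ≤ k, N₀ j ≤ N) (Nat.zero_le N)
        (fun j hj => by rwa [Nat.le_zero.1 hj])
    exact hN₀ _ _ (hspec _ le_rfl)

section

variable {H : Type*} [NormedAddCommGroup H] [InnerProductSpace ℂ H] [CompleteSpace H]

/-- An increasing sequence of orthogonal projections fixes the vectors in the earlier ranges. -/
theorem apply_eq_self_of_mem_range_of_le {P : ℕ → H →L[ℂ] H}
    (hsa : ∀ k, IsSelfAdjoint (P k)) (hidem : ∀ k, (P k).comp (P k) = P k)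
    (hmono : ∀ k, (P k).comp (P (k + 1)) = P k) {j k : ℕ} (hjk : j ≤ k) {x : H}
    (hx : x ∈ Set.range (P j)) : P k x = x := by
  have hsucc (n : ℕ) : P (n + 1) * P n = P n := by
    have h := congrArg star (show P n * P (n + 1) = P n from hmono n)
    rwa [star_mul, (hsa n).star_eq, (hsa (n + 1)).star_eq] at h
  have hfix (n : ℕ) {y : H} (hy : y ∈ Set.range (P n)) : P n y = y := by
    obtain ⟨z, rfl⟩ := hy
    exact DFunLike.congr_fun (hidem n) z
  induction k, hjk using Nat.le_induction with
  | base => exact hfix j hx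
  | succ n _ ih =>
    rw [← ih]
    exact DFunLike.congr_fun (hsucc n) x

/-- An increasing sequence of orthogonal projections whose ranges have dense union converges
strongly to the identity. -/
theorem tendsto_apply_self_of_dense_iUnion_range {P : ℕ → H →L[ℂ] H}
    (hsa : ∀ k, IsSelfAdjoint (P k)) (hidem : ∀ k, (P k).comp (P k) = P k)
    (hmono : ∀ k, (P k).comp (P (k + 1)) = P k) (hdense : Dense (⋃ k, Set.range (P k)))
    (x : H) : Tendsto (fun k => P k x) atTop (𝓝 x) := by
  refine Metric.tendsto_atTop.2 fun ε hε => ?_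
  obtain ⟨y, hy, hxy⟩ := Metric.dense_iff.1 hdense x (ε / 2) (half_pos hε)
  obtain ⟨j, hj⟩ := Set.mem_iUnion.1 hxy
  refine ⟨j, fun k hk => ?_⟩
  have hPy := apply_eq_self_of_mem_range_of_le hsa hidem hmono hk hj
  have hP : ‖P k‖ ≤ 1 := IsStarProjection.norm_le (P k) ⟨hidem k, hsa k⟩
  have hyx : dist y x < ε / 2 := hy
  calc dist (P k x) x ≤ dist (P k x) (P k y) + dist (P k y) x := dist_triangle _ _ _
    _ ≤ dist x y + dist y x := by
      rw [hPy]
      gcongr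
      rw [dist_eq_norm, dist_eq_norm]
      nth_rw 1 [← hPy]
      rw [← map_sub]
      exact (P k).le_of_opNorm_le_of_le hP le_rfl |>.trans_eq (one_mul _)
    _ < ε := by rw [dist_comm x y]; linarith

end

/-- Lemma E.2: uniform convergence of `V_N† V_N` to `1` on a filtration of subspaces
(given by nondecreasing orthogonal projections `P k` with dense union of ranges)
yields a choice `k(N) → ∞` such that the modified encodings `Ṽ_N = V_N ∘ P_{k(N)}`
are uniformly bounded, asymptotically isometric in the strong operator sense, and
agree asymptotically with `V_N` on the union of the ranges. -/
theorem uniform_filtration_convergence_gives_bounded_modification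
    {H : Type*} [NormedAddCommGroup H] [InnerProductSpace ℂ H] [CompleteSpace H]
    (K : ℕ → Type*) [∀ N, NormedAddCommGroup (K N)] [∀ N, InnerProductSpace ℂ (K N)]
    [∀ N, CompleteSpace (K N)]
    (V : ∀ N, H →L[ℂ] K N)
    (P : ℕ → H →L[ℂ] H)
    (hsa : ∀ k, IsSelfAdjoint (P k))
    (hidem : ∀ k, (P k).comp (P k) = P k)
    (hmono : ∀ k, (P k).comp (P (k + 1)) = P k)
    (hdense : Dense (⋃ k, Set.range ⇑(P k)))
    (hunif : ∀ ε : ℝ, 0 < ε → ∀ k, ∃ N₀, ∀ N ≥ N₀,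
      ‖(P k).comp
        ((((ContinuousLinearMap.adjoint (V N)).comp (V N)) - 1).comp (P k))‖ ≤ ε) :
    ∃ k : ℕ → ℕ, Monotone k ∧ Tendsto k atTop atTop ∧
      Tendsto
        (fun N =>
          ‖(ContinuousLinearMap.adjoint ((V N).comp (P (k N)))).comp
              ((V N).comp (P (k N))) - P (k N)‖) atTop (𝓝 0) ∧
      (∃ C : ℝ, ∀ N, ‖(V N).comp (P (k N))‖ ≤ C) ∧
      (∀ ψ : H,
        Tendsto
          (fun N =>
            ‖((ContinuousLinearMap.adjoint ((V N).comp (P (k N)))).comp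
                ((V N).comp (P (k N))) - 1) ψ‖) atTop (𝓝 0)) ∧
      (∀ ψ ∈ ⋃ k', Set.range ⇑(P k'),
        Tendsto (fun N => ‖(V N) ψ - ((V N).comp (P (k N))) ψ‖) atTop (𝓝 0)) := by
  have hev (k : ℕ) : ∀ᶠ N in atTop,
      ‖(P k).comp (((adjoint (V N)).comp (V N) - 1).comp (P k))‖ ≤ 1 / ((k : ℝ) + 1) :=
    eventually_atTop.2 (hunif _ Nat.one_div_pos_of_nat k)
  obtain ⟨k, hk_mono, hk_top, hk⟩ := exists_monotone_tendsto_eventually_diagonal hev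
  have hP (n : ℕ) : ‖P n‖ ≤ 1 := IsStarProjection.norm_le (P n) ⟨hidem n, hsa n⟩
  have hcompress (N n : ℕ) :
      (adjoint ((V N).comp (P n))).comp ((V N).comp (P n)) - P n
        = (P n).comp (((adjoint (V N)).comp (V N) - 1).comp (P n)) := by
    ext x
    have hx : P n (P n x) = P n x := DFunLike.congr_fun (hidem n) x
    simp [adjoint_comp, (hsa n).adjoint_eq, hx]
  have hlim : Tendsto (fun N => ‖(adjoint ((V N).comp (P (k N)))).comp
      ((V N).comp (P (k N))) - P (k N)‖) atTop (𝓝 0) := by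
    refine squeeze_zero' (Eventually.of_forall fun _ => norm_nonneg _) ?_
      (tendsto_one_div_add_atTop_nhds_zero_nat.comp hk_top)
    filter_upwards [hk] with N hN
    rw [hcompress]
    exact hN
  refine ⟨k, hk_mono, hk_top, hlim, ?_, fun ψ => ?_, fun ψ hψ => ?_⟩
  · obtain ⟨B, hB⟩ := hlim.bddAbove_range
    refine ⟨√(B + 1), fun N => Real.le_sqrt_of_sq_le ?_⟩
    rw [sq, ← norm_adjoint_comp_self]
    calc _ ≤ _ := norm_le_norm_sub_add _ (P (k N))
      _ ≤ B + 1 := add_le_add (hB ⟨N, rfl⟩) (hP _)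
  · have hstrong := (tendsto_apply_self_of_dense_iUnion_range hsa hidem hmono hdense ψ).comp hk_top
    refine squeeze_zero (fun _ => norm_nonneg _) (fun N => ?_)
      (by simpa only [zero_mul, add_zero] using
        (hlim.mul_const ‖ψ‖).add (tendsto_iff_norm_sub_tendsto_zero.1 hstrong))
    set A := (adjoint ((V N).comp (P (k N)))).comp ((V N).comp (P (k N)))
    calc ‖(A - 1) ψ‖ = ‖(A - P (k N)) ψ + (P (k N) ψ - ψ)‖ := by simp
      _ ≤ ‖A - P (k N)‖ * ‖ψ‖ + ‖P (k N) ψ - ψ‖ :=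
        (norm_add_le _ _).trans (by gcongr; exact le_opNorm _ _)
  · obtain ⟨j, hj⟩ := Set.mem_iUnion.1 hψ
    refine tendsto_const_nhds.congr' ?_
    filter_upwards [hk_top.eventually_ge_atTop j] with N hN
    simp [apply_eq_self_of_mem_range_of_le hsa hidem hmono hN hj]
end

section
/- Let k ∈ ℕ and let M be a k × k Hermitian complex matrix. Suppose that for every real t > 0 the matrix with entries exp(t · M_{ij}) (entrywise exponential) is positive semidefinite. Then M is conditionally positive semidefinite: for every p : Fin k → ℂ with Σ_i p_i = 0, the quadratic form Σ_{i,j} conj(p_i) M_{ij} p_j is a nonnegative real number. -/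
open scoped ComplexOrder

theorem Complex.hasDerivAt_exp_ofReal_mul_zero (a : ℂ) :
    HasDerivAt (fun t : ℝ => Complex.exp ((t : ℂ) * a)) a 0 := by
  have h : HasDerivAt (fun t : ℝ => (t : ℂ) * a) a 0 := by
    simpa using (Complex.ofRealCLM.hasDerivAt (x := (0 : ℝ))).mul_const a
  simpa using h.cexp

/-- Scaling argument of Section 3.3: if the entrywise exponentials `exp(t·M)` of a
Hermitian matrix `M` are positive semidefinite for all `t > 0`, then `M` is
conditionally positive semidefinite. -/
theorem entrywise_exp_posSemidef_implies_conditionally_posSemidef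
    {k : ℕ} (M : Matrix (Fin k) (Fin k) ℂ) (hM : M.IsHermitian)
    (hpos : ∀ t : ℝ, 0 < t →
      (Matrix.of fun i j => Complex.exp ((t : ℂ) * M i j)).PosSemidef) :
    ∀ p : Fin k → ℂ, (∑ i, p i) = 0 →
      0 ≤ ∑ i, ∑ j, (starRingEnd ℂ) (p i) * M i j * p j := by
  intro p hp
  have hderiv : HasDerivAt
      (fun t : ℝ => ∑ i, ∑ j, (starRingEnd ℂ) (p i) * Complex.exp ((t : ℂ) * M i j) * p j)
      (∑ i, ∑ j, (starRingEnd ℂ) (p i) * M i j * p j) 0 :=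
    HasDerivAt.fun_sum fun i _ => HasDerivAt.fun_sum fun j _ =>
      ((Complex.hasDerivAt_exp_ofReal_mul_zero (M i j)).const_mul _).mul_const _
  have hzero :
      ∑ i, ∑ j, (starRingEnd ℂ) (p i) * Complex.exp (((0 : ℝ) : ℂ) * M i j) * p j = 0 := by
    simp [← Finset.mul_sum, hp]
  refine ge_of_tendsto hderiv.tendsto_slope_zero_right ?_
  filter_upwards [self_mem_nhdsWithin] with t (ht : 0 < t)
  rw [hzero, sub_zero, zero_add]
  refine smul_nonneg (inv_nonneg.mpr ht.le) ?_
  simpa [dotProduct, Matrix.mulVec, Finset.mul_sum, mul_assoc] using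
    (hpos t ht).dotProduct_mulVec_nonneg p
end

section
/- Let E be a real vector space, α : E × E → ℝ a symmetric bilinear form and β : E × E → ℝ an antisymmetric bilinear form. Suppose that for every k ∈ ℕ, every family h : Fin k → E and every real t > 0, the k × k complex matrix with entries exp(t·(α(h_i, h_j) + i·β(h_i, h_j))) is positive semidefinite. Then for all h₁, h₂ ∈ E the compatibility bound holds: β(h₁, h₂)² ≤ α(h₁, h₁) · α(h₂, h₂). -/
open scoped ComplexOrder

/-- A function that vanishes at `0` and is nonnegative to the right of `0` has nonnegative
derivative at `0`. -/
theorem HasDerivAt.nonneg_of_nonneg_right {f : ℝ → ℝ} {f' : ℝ} (hf : HasDerivAt f f' 0)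
    (h0 : f 0 = 0) (hnn : ∀ t, 0 < t → 0 ≤ f t) : 0 ≤ f' := by
  refine ge_of_tendsto hf.tendsto_slope_zero_right ?_
  filter_upwards [self_mem_nhdsWithin] with t ht
  have ht : 0 < t := ht
  simpa [h0] using mul_nonneg (inv_nonneg.2 ht.le) (hnn t ht)

/-- Positivity of the exponentiated kernel on the family `(0, h₁, h₂)`, tested against the vector
`(-(p + i), p, i)`. -/
theorem exp_gram_test_nonneg {E : Type*} [AddCommGroup E] [Module ℝ E]
    (α β : E →ₗ[ℝ] E →ₗ[ℝ] ℝ)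
    (hsym : ∀ x y, α x y = α y x) (hanti : ∀ x y, β x y = -β y x) (h₁ h₂ : E) (t : ℝ)
    (hpos : (Matrix.of fun i j : Fin 3 =>
      Complex.exp ((t : ℂ) * ((α (![0, h₁, h₂] i) (![0, h₁, h₂] j) : ℂ) +
        (β (![0, h₁, h₂] i) (![0, h₁, h₂] j) : ℂ) * Complex.I))).PosSemidef) (p : ℝ) :
    0 ≤ p ^ 2 * Real.exp (t * α h₁ h₁) + Real.exp (t * α h₂ h₂)
      - 2 * p * (Real.exp (t * α h₁ h₂) * Real.sin (t * β h₁ h₂)) - (p ^ 2 + 1) := by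
  have hdiag : ∀ x, β x x = 0 := fun x => by linarith [hanti x x]
  have key := hpos.dotProduct_mulVec_nonneg ![-(p + Complex.I), (p : ℂ), Complex.I]
  have hre := (Complex.le_def.1 key).1
  simp [Matrix.mulVec, dotProduct, Fin.sum_univ_three, Complex.exp_re, Complex.exp_im, hdiag,
    hsym h₂ h₁, hanti h₂ h₁] at hre
  linarith

/-- Section 3.3: positivity of the limiting Gram matrices of Weyl unitaries, i.e.
positive semidefiniteness of the matrices `exp(t(α(h_i,h_j) + iβ(h_i,h_j)))` for all
`t > 0`, implies the compatibility bound `β(h₁,h₂)² ≤ α(h₁,h₁)α(h₂,h₂)`. -/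
theorem weyl_gram_positivity_implies_compatibility_bound
    {E : Type*} [AddCommGroup E] [Module ℝ E]
    (α β : E →ₗ[ℝ] E →ₗ[ℝ] ℝ)
    (hsym : ∀ x y, α x y = α y x) (hanti : ∀ x y, β x y = -β y x)
    (hpos : ∀ (k : ℕ) (h : Fin k → E) (t : ℝ), 0 < t →
      (Matrix.of fun i j =>
        Complex.exp ((t : ℂ) *
          ((α (h i) (h j) : ℂ) + (β (h i) (h j) : ℂ) * Complex.I))).PosSemidef) :
    ∀ h₁ h₂ : E, (β h₁ h₂) ^ 2 ≤ α h₁ h₁ * α h₂ h₂ := by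
  intro h₁ h₂
  have hquad : ∀ p : ℝ, 0 ≤ α h₁ h₁ * (p * p) + (-2 * β h₁ h₂) * p + α h₂ h₂ := by
    intro p
    have hexp : ∀ c : ℝ, HasDerivAt (fun t : ℝ => Real.exp (t * c)) c 0 := fun c => by
      simpa using ((hasDerivAt_id (0 : ℝ)).mul_const c).exp
    have hsin : HasDerivAt (fun t : ℝ => Real.sin (t * β h₁ h₂)) (β h₁ h₂) 0 := by
      simpa using ((hasDerivAt_id (0 : ℝ)).mul_const (β h₁ h₂)).sin
    have hder := ((((hexp (α h₁ h₁)).const_mul (p ^ 2)).add (hexp (α h₂ h₂))).sub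
      (((hexp (α h₁ h₂)).mul hsin).const_mul (2 * p))).sub_const (p ^ 2 + 1)
    have hnn := hder.nonneg_of_nonneg_right (by simp) fun t ht =>
      exp_gram_test_nonneg α β hsym hanti h₁ h₂ t (hpos 3 ![0, h₁, h₂] t ht) p
    simp at hnn
    linarith
  have hdisc := discrim_le_zero hquad
  rw [discrim] at hdisc
  linarith
end
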